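/- Let ℓ > 1 and let I be a finite type of n agents with n ≥ ℓ; assume each R i is an equivalence relation and R satisfies the weak commutativity frame property of degree ℓ. Then any two worlds w, w' related by the reflexive-transitive closure of the union of all the relations R i are connected by a path of length at most n: there exists a list l of agents with length ≤ n such that comp(l) w w'. (Appendix corollary for wC_ℓ-S5_n: mutually reachable worlds are connected by a path of length at most n.) -/

import Mathlib

/-- Relational composition along a list of agents. -/
def comp {W I : Type*} (R : I → W → W → Prop) : List I → W → W → Prop
  | [], w, v => w = v
  | i :: l, w, v => ∃ u, R i w u ∧ comp R l u v

/-- The weak commutativity frame property of degree `ℓ`. -/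
def WeakCommFrame {W I : Type*} (R : I → W → W → Prop) (ℓ : ℕ) : Prop :=
  ∀ L π : List I, L.Nodup → L.length = ℓ → π.Perm L →
    ∀ w v : W, comp R π w v → comp R L w v

theorem comp_append {W I : Type*} (R : I → W → W → Prop) (l m : List I) (w v : W) :
    comp R (l ++ m) w v ↔ ∃ u, comp R l w u ∧ comp R m u v := by
  induction l generalizing w with
  | nil => simp [comp]
  | cons i l ih =>
    simp only [List.cons_append, comp, ih]
    constructor
    · rintro ⟨u, hu, x, hx, hv⟩
      exact ⟨x, ⟨u, hu, hx⟩, hv⟩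
    · rintro ⟨x, ⟨u, hu, hx⟩, hv⟩
      exact ⟨u, hu, x, hx, hv⟩

theorem comp_refl {W I : Type*} {R : I → W → W → Prop} (hR : ∀ i w, R i w w)
    (l : List I) (w : W) : comp R l w w := by
  induction l with
  | nil => rfl
  | cons i l ih => exact ⟨w, hR i w, ih⟩

/-- Weak commutativity allows swapping the first two agents of a long enough list. -/
theorem WeakCommFrame.comp_swap {W I : Type*} {R : I → W → W → Prop} {ℓ : ℕ}
    (hC : WeakCommFrame R ℓ) (hℓ : 1 < ℓ) {a b : I} {m : List I}
    (hnd : (a :: b :: m).Nodup) (hlen : ℓ ≤ (a :: b :: m).length) {w v : W}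
    (h : comp R (a :: b :: m) w v) : comp R (b :: a :: m) w v := by
  have split (x y : I) : x :: y :: m = (x :: y :: m.take (ℓ - 2)) ++ m.drop (ℓ - 2) := by
    simp
  rw [split, comp_append] at h ⊢
  obtain ⟨u, hu, hv⟩ := h
  refine ⟨u, hC _ _ ?_ ?_ (List.Perm.swap _ _ _) _ _ hu, hv⟩
  · have hnd' := ((List.Perm.swap a b m).nodup_iff).2 hnd
    rw [split] at hnd'
    exact hnd'.of_append_left
  · simp only [List.length_cons, List.length_take] at hlen ⊢
    omega

/-- Weak commutativity of degree `ℓ > 1` extends to all larger degrees. -/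
theorem WeakCommFrame.mono {W I : Type*} {R : I → W → W → Prop} {ℓ k : ℕ}
    (hC : WeakCommFrame R ℓ) (hℓ : 1 < ℓ) (hk : ℓ ≤ k) : WeakCommFrame R k := by
  classical
  induction k, hk using Nat.le_induction with
  | base => exact hC
  | succ k hk ih =>
    intro L π hL hlen hperm w v h
    match L, π with
    | [], _ => simp at hlen
    | _ :: _, [] => simp at hperm
    | b :: l, a :: p =>
      have hl : l.length = k := by simpa using hlen
      by_cases hab : a = b
      · subst hab
        obtain ⟨u, hu, hv⟩ := h
        exact ⟨u, hu, ih _ _ hL.of_cons hl hperm.cons_inv _ _ hv⟩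
      · have hnd : (a :: p).Nodup := hperm.nodup_iff.2 hL
        have hplen : p.length = k := by simpa [hl] using hperm.length_eq
        have hb : b ∈ p := by
          have : b ∈ a :: p := hperm.mem_iff.2 List.mem_cons_self
          exact (List.mem_cons.1 this).resolve_left (Ne.symm hab)
        have hp : p.Perm (b :: p.erase b) := List.perm_cons_erase hb
        obtain ⟨u, hu, hv⟩ := h
        have h' : comp R (a :: b :: p.erase b) w v :=
          ⟨u, hu, ih _ _ (hp.nodup_iff.1 hnd.of_cons) (hp.length_eq ▸ hplen) hp _ _ hv⟩
        have hnd' : (a :: b :: p.erase b).Nodup := (hp.cons a).nodup_iff.1 hnd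
        have hlen' : ℓ ≤ (a :: b :: p.erase b).length := by
          rw [← (hp.cons a).length_eq, List.length_cons]
          omega
        obtain ⟨x, hx, hxv⟩ := hC.comp_swap hℓ hnd' hlen' h'
        have hperm' : (a :: p.erase b).Perm l :=
          ((List.Perm.swap a b _).trans ((hp.cons a).symm.trans hperm)).cons_inv
        exact ⟨x, hx, ih _ _ hL.of_cons hl hperm' _ _ hxv⟩

/-- Appendix corollary for wC_ℓ-S5ₙ: any world reachable via the reflexive-transitive
closure of the union of all the relations is reachable by a path of length at most
`n`, the number of agents. -/
theorem reachable_by_short_path_weak {W I : Type*} [Fintype I]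
    (R : I → W → W → Prop) (hEq : ∀ i, Equivalence (R i))
    (ℓ : ℕ) (hℓ : 1 < ℓ) (hn : ℓ ≤ Fintype.card I) (hC : WeakCommFrame R ℓ) :
    ∀ w w' : W, Relation.ReflTransGen (fun a b => ∃ i, R i a b) w w' →
      ∃ l : List I, l.length ≤ Fintype.card I ∧ comp R l w w' := by
  classical
  intro w w' h
  have hF := hC.mono hℓ hn
  have hnd : (Finset.univ : Finset I).toList.Nodup := Finset.nodup_toList _
  have hlen : (Finset.univ : Finset I).toList.length = Fintype.card I := by simp
  refine ⟨Finset.univ.toList, hlen.le, ?_⟩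
  induction h using Relation.ReflTransGen.head_induction_on with
  | refl => exact comp_refl (fun i => (hEq i).refl) _ _
  | head hstep _ ih =>
    obtain ⟨i, hi⟩ := hstep
    have hp := List.perm_cons_erase (Finset.mem_toList.2 (Finset.mem_univ i))
    obtain ⟨u, hu, hv⟩ :=
      hF _ _ (hp.nodup_iff.1 hnd) (hp.length_eq ▸ hlen) hp _ _ ih
    exact hF _ _ hnd hlen hp.symm _ _ ⟨u, (hEq i).trans hi hu, hv⟩
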